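/- For an odd prime power q and integer m ≥ 2, let (V,B) be the S(2,q,q^m) formed by points and lines of AG(m,q). For any configuration C ⊆ B with 1 < |C| ≤ 2q−1, it holds that |C| + odd(C) ≥ 2q, where odd(C) is the number of points contained in an odd number of blocks of C. -/

import Mathlib

namespace PlaneAux

open Finset

set_option linter.unusedSectionVars false

variable {D F P : Type} [Fintype D] [Fintype F] [Fintype P]
  [DecidableEq D] [DecidableEq F] [DecidableEq P]

/-- degree of a point with respect to the set `S` of lines. -/
def deg (f : D → P → F) (S : Finset (D × F)) (p : P) : ℕ :=
  (univ.filter fun d => (d, f d p) ∈ S).card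

/-- degree of a point, ignoring the line of direction `d`. -/
def exc (f : D → P → F) (S : Finset (D × F)) (d : D) (p : P) : ℕ :=
  (univ.filter fun d' => d' ≠ d ∧ (d', f d' p) ∈ S).card

/-- number of lines of direction `d`. -/
def num (S : Finset (D × F)) (d : D) : ℕ := (univ.filter fun b => (d, b) ∈ S).card

/-- the points of a line. -/
def line (f : D → P → F) (d : D) (b : F) : Finset P := univ.filter fun p => f d p = b

theorem deg_mem (f : D → P → F) (S : Finset (D × F)) (d : D) (p : P) (h : (d, f d p) ∈ S) :
    deg f S p = exc f S d p + 1 := by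
  unfold deg exc
  have : (univ.filter fun d => (d, f d p) ∈ S) =
      insert d (univ.filter fun d' => d' ≠ d ∧ (d', f d' p) ∈ S) := by
    ext x
    by_cases hx : x = d
    · subst hx; simp [h]
    · simp [hx]
  rw [this, card_insert_of_notMem (by simp)]

theorem deg_not_mem (f : D → P → F) (S : Finset (D × F)) (d : D) (p : P) (h : (d, f d p) ∉ S) :
    deg f S p = exc f S d p := by
  unfold deg exc
  congr 1
  ext x
  by_cases hx : x = d
  · subst hx; simp [h]
  · simp [hx]

theorem sum_num (S : Finset (D × F)) : ∑ d, num S d = S.card := by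
  have h : S = univ.filter (fun x : D × F => x ∈ S) := by ext; simp
  conv_rhs => rw [h, card_filter, Fintype.sum_prod_type]
  simp only [num, card_filter]

theorem line_card (f : D → P → F)
    (hf : ∀ d d', d ≠ d' → Function.Bijective fun p => (f d p, f d' p))
    (hD : 2 ≤ Fintype.card D) (d : D) (b : F) : (line f d b).card = Fintype.card F := by
  have : Nontrivial D := Fintype.one_lt_card_iff_nontrivial.mp (by omega)
  obtain ⟨d', hd'⟩ := exists_ne d
  have hb := hf d d' hd'.symm
  rw [← Finset.card_univ (α := F)]
  refine Finset.card_bij (fun p _ => f d' p) (by simp) ?_ ?_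
  · intro p hp p' hp' h
    simp [line] at hp hp'
    exact hb.1 (by simp [hp, hp', h])
  · intro y _
    obtain ⟨p, hp⟩ := hb.2 (b, y)
    simp at hp
    exact ⟨p, by simp [line, hp.1], hp.2⟩

theorem sum_exc (f : D → P → F)
    (hf : ∀ d d', d ≠ d' → Function.Bijective fun p => (f d p, f d' p))
    (S : Finset (D × F)) (d : D) (b : F) :
    ∑ p ∈ line f d b, exc f S d p + num S d = S.card := by
  have h1 : ∀ d', d' ≠ d → ∑ p ∈ line f d b, (if (d', f d' p) ∈ S then 1 else 0) = num S d' := by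
    intro d' hd'
    have hb := hf d d' hd'.symm
    rw [← card_filter, num]
    refine Finset.card_bij (fun p _ => f d' p) (by simp) ?_ ?_
    · intro p hp p' hp' h
      simp [line] at hp hp'
      exact hb.1 (by simp [hp, hp', h])
    · intro y hy
      obtain ⟨p, hp⟩ := hb.2 (b, y)
      simp at hp hy
      exact ⟨p, by simp [line, hp.1, hp.2, hy], hp.2⟩
  have h2 : ∑ p ∈ line f d b, exc f S d p = ∑ d' ∈ univ.erase d, num S d' := by
    have : ∀ p, exc f S d p = ∑ d' ∈ univ.erase d, (if (d', f d' p) ∈ S then 1 else 0) := by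
      intro p
      rw [← card_filter, exc]
      congr 1
      ext x; simp
    simp_rw [this]
    rw [sum_comm]
    exact sum_congr rfl fun d' hd' => h1 d' (by simpa using hd')
  rw [h2, sum_erase_add _ _ (mem_univ d), sum_num]

/-- points of odd degree -/
def oddPts (f : D → P → F) (S : Finset (D × F)) : Finset P :=
  univ.filter fun p => ¬ Even (deg f S p)

theorem deg_one (f : D → P → F)
    (hf : ∀ d d', d ≠ d' → Function.Bijective fun p => (f d p, f d' p))
    (hD : 2 ≤ Fintype.card D) (S : Finset (D × F)) (d : D) (b : F) (h : (d, b) ∈ S) :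
    Fintype.card F + num S d ≤ ((line f d b).filter fun p => deg f S p = 1).card + S.card := by
  have h1 := sum_exc f hf S d b
  have h2 := line_card f hf hD d b
  have h3 := Finset.card_filter_add_card_filter_not (s := line f d b) (fun p => deg f S p = 1)
  have h4 : ((line f d b).filter fun p => ¬ deg f S p = 1).card ≤
      ∑ p ∈ line f d b, exc f S d p := by
    rw [card_filter]
    refine sum_le_sum fun p hp => ?_
    have hp' : f d p = b := by simpa [line] using hp
    have := deg_mem f S d p (hp' ▸ h)
    split_ifs <;> omega
  omega

theorem num_pos (S : Finset (D × F)) (d : D) (b : F) (h : (d, b) ∈ S) : 1 ≤ num S d := by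
  apply Finset.card_pos.mpr
  exact ⟨b, by simp [h]⟩

theorem small_case (f : D → P → F)
    (hf : ∀ d d', d ≠ d' → Function.Bijective fun p => (f d p, f d' p))
    (hD : 2 ≤ Fintype.card D) (S : Finset (D × F)) (h1 : 1 < S.card)
    (h2 : S.card ≤ Fintype.card F) :
    2 * Fintype.card F ≤ S.card + (oddPts f S).card := by
  have h := Finset.card_mul_le_card_mul (s := S) (t := univ.filter fun p => deg f S p = 1)
    (fun x p => f x.1 p = x.2) (m := Fintype.card F - S.card + 1) (n := 1) ?_ ?_
  · have h3 : (univ.filter fun p => deg f S p = 1).card ≤ (oddPts f S).card := by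
      apply card_le_card
      intro p hp
      simp at hp
      simp [oddPts, hp]
    obtain ⟨j, hj⟩ := Nat.exists_eq_add_of_le h2
    obtain ⟨i, hi⟩ := Nat.exists_eq_add_of_le h1
    have : Fintype.card F - S.card = j := by omega
    rw [this] at h
    rw [hi] at h hj ⊢
    rw [hj]
    nlinarith [Nat.zero_le (i * j)]
  · rintro ⟨d, b⟩ hx
    have h5 := deg_one f hf hD S d b hx
    have h6 := num_pos S d b hx
    have : bipartiteAbove (fun (x : D × F) p => f x.1 p = x.2)
      (univ.filter fun p => deg f S p = 1) (d, b) = (line f d b).filter fun p => deg f S p = 1 := by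
      ext p; simp [bipartiteAbove, line, and_comm]
    rw [this]
    omega
  · intro p hp
    simp at hp
    rw [← hp, deg]
    refine card_le_card_of_injOn (fun x => x.1) ?_ ?_
    · rintro ⟨d, b⟩ hx
      simp [bipartiteBelow] at hx ⊢
      rw [hx.2]; exact hx.1
    · rintro ⟨d, b⟩ hx ⟨d', b'⟩ hx' h
      simp [bipartiteBelow] at hx hx' h
      subst h
      simp [← hx.2, ← hx'.2]

theorem plane (f : D → P → F)
    (hf : ∀ d d', d ≠ d' → Function.Bijective fun p => (f d p, f d' p))
    (hq : Odd (Fintype.card F))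
    (hD : Fintype.card D = Fintype.card F + 1) (S : Finset (D × F)) (h1 : 1 < S.card) :
    2 * Fintype.card F ≤ S.card + (oddPts f S).card := by
  have hqpos := hq.pos
  have hD2 : 2 ≤ Fintype.card D := by omega
  by_cases hsmall : S.card ≤ Fintype.card F
  · exact small_case f hf hD2 S h1 hsmall
  push Not at hsmall
  -- parity of the number of points with odd `exc`
  have hpar : ∀ d b, (Odd ((line f d b).filter fun p => Odd (exc f S d p)).card ↔
      Odd (S.card + num S d)) := by
    intro d b
    rw [← Finset.odd_sum_iff_odd_card_odd, ← sum_exc f hf S d b]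
    simp only [Nat.odd_iff]; omega
  by_cases hex : ∃ d, Odd (S.card + num S d)
  · obtain ⟨d, hd⟩ := hex
    have hnot : ∀ b, (d, b) ∉ S → b ∈ (oddPts f S).image (f d) := by
      intro b hb
      obtain ⟨p, hp⟩ := Finset.card_pos.mp ((hpar d b).mpr hd).pos
      simp [line] at hp
      rw [mem_image]
      refine ⟨p, ?_, hp.1⟩
      simp only [oddPts, mem_filter, mem_univ, true_and]
      rw [deg_not_mem f S d p (by rw [hp.1]; exact hb)]
      simpa using hp.2
    have hnum : (univ.filter fun b => (d, b) ∉ S).card + num S d = Fintype.card F := by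
      have := Finset.card_filter_add_card_filter_not (s := (univ : Finset F)) (fun b => (d, b) ∈ S)
      rw [Finset.card_univ] at this
      unfold num
      omega
    have himg : ((oddPts f S).image (f d)).card ≤ (oddPts f S).card := card_image_le
    by_cases hbig : S.card < num S d + Fintype.card F
    · have : (univ : Finset F) ⊆ (oddPts f S).image (f d) := by
        intro b _
        by_cases hb : (d, b) ∈ S
        · have := deg_one f hf hD2 S d b hb
          obtain ⟨p, hp⟩ := Finset.card_pos.mp
            (show 0 < ((line f d b).filter fun p => deg f S p = 1).card by omega)
          simp [line] at hp
          rw [mem_image]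
          exact ⟨p, by simp [oddPts, hp.2], hp.1⟩
        · exact hnot b hb
      have := card_le_card this
      rw [Finset.card_univ] at this
      omega
    · have : (univ.filter fun b => (d, b) ∉ S) ⊆ (oddPts f S).image (f d) := by
        intro b hb
        exact hnot b (by simpa using hb)
      have := card_le_card this
      omega
  · push Not at hex
    have heven : ∀ d, Even (S.card + num S d) := fun d => Nat.not_odd_iff_even.mp (hex d)
    have hc : Even S.card := by
      have h : Even (∑ d, (S.card + num S d)) := Finset.even_sum _ fun d _ => heven d
      rw [sum_add_distrib, sum_num, sum_const, Finset.card_univ, hD, smul_eq_mul] at h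
      have h' : Even ((Fintype.card F + 1) * S.card) := (hq.add_one).mul_right _
      exact (Nat.even_add.mp h).mp h'
    obtain ⟨⟨d, b⟩, hL⟩ := Finset.card_pos.mp (show 0 < S.card by omega)
    have hpos := num_pos S d b hL
    have hsum := sum_exc f hf S d b
    have hlc := line_card f hf hD2 d b
    -- there is an odd point of small degree
    have hP : ∃ p, ¬ Even (deg f S p) ∧ deg f S p + Fintype.card F ≤ S.card + 2 := by
      by_contra! hcon
      have hdeg : ∀ p ∈ line f d b, deg f S p = exc f S d p + 1 := by
        intro p hp
        have hp' : f d p = b := by simpa [line] using hp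
        exact deg_mem f S d p (hp' ▸ hL)
      have hx : ∃ p ∈ line f d b, ¬ Odd (exc f S d p) := by
        by_contra! hall
        have := (hpar d b)
        rw [filter_true_of_mem hall, hlc] at this
        exact hex d (this.mp hq)
      obtain ⟨p, hp, hpe⟩ := hx
      have hpd := hdeg p hp
      have hpodd : ¬ Even (deg f S p) := by
        rw [hpd, Nat.even_add_one, not_not]; exact Nat.not_odd_iff_even.mp hpe
      have hlow := hcon p hpodd
      have hge : ∀ p' ∈ (line f d b).erase p, 1 ≤ exc f S d p' := by
        intro p' hp'
        have hm := mem_of_mem_erase hp'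
        have h3 := hdeg p' hm
        by_contra h0
        have h4 : deg f S p' = 1 := by omega
        have h5 := hcon p' (by rw [h4]; decide)
        omega
      have hs : ((line f d b).erase p).card • 1 ≤ ∑ x ∈ (line f d b).erase p, exc f S d x :=
        Finset.card_nsmul_le_sum _ _ _ hge
      rw [card_erase_of_mem hp, hlc] at hs
      have hsp := Finset.sum_erase_add _ (fun p => exc f S d p) hp
      simp only [smul_eq_mul, mul_one] at hs
      omega
    obtain ⟨p, hpo, hpd⟩ := hP
    have hother : ∀ d', ∃ p', (d', f d' p) ∉ S → p' ≠ p ∧ f d' p' = f d' p ∧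
        ¬ Even (deg f S p') := by
      intro d'
      by_cases hd' : (d', f d' p) ∈ S
      · exact ⟨p, fun h => absurd hd' h⟩
      have h3 : ¬ Odd ((line f d' (f d' p)).filter fun p => Odd (exc f S d' p)).card := by
        rw [hpar]; exact hex d'
      have hmem : p ∈ (line f d' (f d' p)).filter fun p => Odd (exc f S d' p) := by
        simp only [line, mem_filter, mem_univ, true_and]
        rw [← deg_not_mem f S d' p hd']
        exact Nat.not_even_iff_odd.mp hpo
      have h4 : 1 < ((line f d' (f d' p)).filter fun p => Odd (exc f S d' p)).card := by
        have := Finset.card_pos.mpr ⟨p, hmem⟩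
        rcases Nat.lt_or_ge 1 ((line f d' (f d' p)).filter fun p => Odd (exc f S d' p)).card with h | h
        · exact h
        · exfalso; apply h3
          rw [show ((line f d' (f d' p)).filter fun p => Odd (exc f S d' p)).card = 1 by omega]
          exact odd_one
      obtain ⟨p', hp', hne⟩ := Finset.exists_mem_ne h4 p
      simp only [line, mem_filter, mem_univ, true_and] at hp'
      refine ⟨p', fun _ => ⟨hne, hp'.1, ?_⟩⟩
      rw [deg_not_mem f S d' p' (by rw [hp'.1]; exact hd')]
      exact Nat.not_even_iff_odd.mpr hp'.2
    choose g hg using hother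
    have hcount : (univ.filter fun d' => (d', f d' p) ∉ S).card ≤ ((oddPts f S).erase p).card := by
      refine card_le_card_of_injOn g ?_ ?_
      · intro d' hd'
        have := hg d' (by simpa using hd')
        simp [oddPts, this.1]
        simpa using this.2.2
      · intro d₁ hd₁ d₂ hd₂ h
        by_contra hne
        have e1 := hg d₁ (by simpa using hd₁)
        have e2 := hg d₂ (by simpa using hd₂)
        apply e1.1
        apply (hf d₁ d₂ hne).1
        simp [e1.2.1]
        rw [h, e2.2.1]
    have hpm : p ∈ oddPts f S := by simpa [oddPts] using hpo
    rw [card_erase_of_mem hpm] at hcount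
    have hpos2 := Finset.card_pos.mpr ⟨p, hpm⟩
    have := Finset.card_filter_add_card_filter_not (s := (univ : Finset D))
      (fun d' => (d', f d' p) ∈ S)
    rw [Finset.card_univ, hD] at this
    unfold deg at hpd
    omega


/-- the coordinate functions of the affine plane `F × F`, one per direction. -/
def pf {F : Type} [Field F] : Option F → F × F → F
  | none, p => p.1
  | some a, p => p.2 - a * p.1

theorem pf_bij {F : Type} [Field F] (d d' : Option F) (h : d ≠ d') :
    Function.Bijective fun p : F × F => (pf d p, pf d' p) := by
  rcases d with _ | a <;> rcases d' with _ | b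
  · exact absurd rfl h
  · constructor
    · rintro ⟨x, y⟩ ⟨x', y'⟩ hh
      simp [pf] at hh
      obtain ⟨rfl, h2⟩ := hh
      simpa using h2
    · rintro ⟨r, s⟩
      exact ⟨(r, s + b * r), by simp [pf]⟩
  · constructor
    · rintro ⟨x, y⟩ ⟨x', y'⟩ hh
      simp [pf] at hh
      obtain ⟨h2, rfl⟩ := hh
      simpa using h2
    · rintro ⟨r, s⟩
      exact ⟨(s, r + a * s), by simp [pf]⟩
  · have hab : a - b ≠ 0 := by
      intro h0; apply h; rw [sub_eq_zero.mp h0]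
    constructor
    · rintro ⟨x, y⟩ ⟨x', y'⟩ hh
      simp [pf] at hh
      obtain ⟨h1, h2⟩ := hh
      have : (a - b) * (x - x') = 0 := by linear_combination h2 - h1
      rcases mul_eq_zero.mp this with h3 | h3
      · exact absurd h3 hab
      · have hx : x = x' := sub_eq_zero.mp h3
        subst hx
        simpa using h1
    · rintro ⟨r, s⟩
      refine ⟨((s - r) / (a - b), r + a * ((s - r) / (a - b))), ?_⟩
      simp only [pf, Prod.mk.injEq]
      constructor
      · ring
      · field_simp
        ring

theorem pf_exists {F : Type} [Field F] (p p' : F × F) : ∃ d, pf d p = pf d p' := by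
  by_cases h : p.1 = p'.1
  · exact ⟨none, h⟩
  · refine ⟨some ((p.2 - p'.2) / (p.1 - p'.1)), ?_⟩
    have : p.1 - p'.1 ≠ 0 := sub_ne_zero.mpr h
    simp only [pf]
    field_simp
    ring

theorem pf_affine {F : Type} [Field F] (d : Option F) (p p' : F × F) (h : pf d p = pf d p') (t : F) :
    pf d (p + t • (p' - p)) = pf d p := by
  rcases d with _ | a
  · simp [pf] at *
    rw [h]; simp
  · simp [pf] at *
    linear_combination (-t) * h

theorem line_inj (f : D → P → F)
    (hf : ∀ d d', d ≠ d' → Function.Bijective fun p => (f d p, f d' p))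
    (hD : 2 ≤ Fintype.card D) (hF : 2 ≤ Fintype.card F) (d d' : D) (b b' : F)
    (h : line f d b = line f d' b') : (d, b) = (d', b') := by
  have h2 := line_card f hf hD d b
  obtain ⟨p, hp, p', hp', hne⟩ := Finset.one_lt_card.mp (show 1 < (line f d b).card by omega)
  have k1 := h ▸ hp
  have k2 := h ▸ hp'
  simp [line] at hp hp' k1 k2
  have hd : d = d' := by
    by_contra hdd
    apply hne
    apply (hf d d' hdd).1
    simp [hp, hp', k1, k2]
  subst hd
  rw [← hp, ← k1]

/-- the line through `x` with direction `d`. -/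
def aline {F V : Type} [Field F] [Fintype F] [AddCommGroup V] [Module F V] [DecidableEq V]
    (x d : V) : Finset V := Finset.univ.image fun t : F => x + t • d

section glue

variable {K V : Type} [Field K] [Fintype K] [DecidableEq K] [AddCommGroup V] [Module K V]
  [Fintype V] [DecidableEq V]

theorem aline_card (x d : V) (hd : d ≠ 0) : (aline (F := K) x d).card = Fintype.card K := by
  rw [aline, card_image_of_injective, Finset.card_univ]
  intro s t h
  simp only [add_right_inj] at h
  exact smul_left_injective K hd h

theorem aline_base (x d y : V) (hy : y ∈ aline (F := K) x d) :
    aline (F := K) x d = aline (F := K) y d := by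
  simp only [aline, mem_image, mem_univ, true_and] at hy
  obtain ⟨t, rfl⟩ := hy
  ext z
  simp only [aline, mem_image, mem_univ, true_and]
  constructor
  · rintro ⟨s, rfl⟩
    exact ⟨s - t, by module⟩
  · rintro ⟨s, rfl⟩
    exact ⟨t + s, by module⟩

theorem mem_aline (x d : V) : x ∈ aline (F := K) x d := by
  simp only [aline, mem_image, mem_univ, true_and]
  exact ⟨0, by simp⟩

theorem aline_two (x d y z : V) (hy : y ∈ aline (F := K) x d) (hz : z ∈ aline (F := K) x d)
    (hne : y ≠ z) : ∀ w ∈ aline (F := K) x d, ∃ t : K, w = y + t • (z - y) := by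
  rw [aline_base x d y hy] at hz ⊢
  simp only [aline, mem_image, mem_univ, true_and] at hz
  obtain ⟨t, rfl⟩ := hz
  have ht : t ≠ 0 := by rintro rfl; simp at hne
  intro w hw
  simp only [aline, mem_image, mem_univ, true_and] at hw
  obtain ⟨s, rfl⟩ := hw
  refine ⟨s / t, ?_⟩
  rw [add_sub_cancel_left, smul_smul, div_mul_cancel₀ _ ht]

theorem glue (hq : Odd (Fintype.card K)) (C : Finset (Finset V))
    (hlines : ∀ L ∈ C, ∃ x d : V, d ≠ 0 ∧ L = aline (F := K) x d)
    (x u v : V) (hu : u ≠ 0) (hv : v ≠ 0)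
    (h1 : aline (F := K) x u ∈ C) (h2 : aline (F := K) x v ∈ C)
    (hne : aline (F := K) x u ≠ aline (F := K) x v) :
    2 * Fintype.card K ≤ C.card +
      (Finset.univ.filter fun p : V => ¬ Even ((C.filter fun L => p ∈ L).card)).card := by
  have hF : 2 ≤ Fintype.card K := Fintype.one_lt_card
  have hDc : Fintype.card (Option K) = Fintype.card K + 1 := Fintype.card_option
  have hD2 : 2 ≤ Fintype.card (Option K) := by omega
  let φ : K × K → V := fun p => x + p.1 • u + p.2 • v
  have hφa : ∀ p p' (t : K), φ (p + t • (p' - p)) = φ p + t • (φ p' - φ p) := by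
    intro p p' t
    simp only [φ, Prod.fst_add, Prod.snd_add, Prod.smul_fst, Prod.smul_snd, Prod.fst_sub,
      Prod.snd_sub, smul_eq_mul]
    module
  have hind : ∀ a b : K, a • u + b • v = 0 → a = 0 ∧ b = 0 := by
    intro a b hab
    by_cases hb : b = 0
    · subst hb
      simp [hu] at hab
      exact ⟨hab, rfl⟩
    · exfalso
      apply hne
      have hvu : v = (-(a / b)) • u := by
        have : b • v = b • ((-(a / b)) • u) := by
          rw [smul_smul, mul_neg, mul_div_cancel₀ _ hb, neg_smul]
          exact eq_neg_of_add_eq_zero_right hab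
        exact smul_right_injective V hb this
      symm
      apply Finset.eq_of_subset_of_card_le
      · intro z hz
        simp only [aline, mem_image, mem_univ, true_and] at hz ⊢
        obtain ⟨t, rfl⟩ := hz
        exact ⟨t * (-(a / b)), by rw [mul_smul, ← hvu]⟩
      · rw [aline_card x u hu, aline_card x v hv]
  have hφ : Function.Injective φ := by
    rintro ⟨a, b⟩ ⟨a', b'⟩ h
    have : (a - a') • u + (b - b') • v = 0 := by
      have h' : x + a • u + b • v = x + a' • u + b' • v := h
      have e : (a - a') • u + (b - b') • v =
          (x + a • u + b • v) - (x + a' • u + b' • v) := by module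
      rw [e, h', sub_self]
    have := hind _ _ this
    simp only [sub_eq_zero] at this
    simp [this.1, this.2]
  let Ls : Option K × K → Finset V := fun y => (line pf y.1 y.2).image φ
  have hLsinj : Function.Injective Ls := by
    rintro ⟨d, b⟩ ⟨d', b'⟩ h
    exact line_inj pf pf_bij hD2 hF d d' b b' (Finset.image_injective hφ h)
  have hLsmem : ∀ p d b, φ p ∈ Ls (d, b) ↔ pf d p = b := by
    intro p d b
    simp only [Ls, mem_image, line, mem_filter, mem_univ, true_and]
    constructor
    · rintro ⟨p', h, h'⟩
      rw [← hφ h']; exact h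
    · intro h; exact ⟨p, h, rfl⟩
  have hLscard : ∀ y, (Ls y).card = Fintype.card K := by
    intro y
    rw [card_image_of_injective _ hφ, line_card pf pf_bij hD2]
  let S : Finset (Option K × K) := univ.filter fun y => Ls y ∈ C
  -- a line of `C` with two points in the plane lies in the plane
  have htwo : ∀ L ∈ C, ∀ p p', φ p ∈ L → φ p' ∈ L → p ≠ p' → L ∈ S.image Ls := by
    intro L hL p p' hp hp' hpp
    obtain ⟨y, w, hw, hLe⟩ := hlines L hL
    obtain ⟨d, hd⟩ := pf_exists p p'
    have hsub : L ⊆ Ls (d, pf d p) := by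
      intro z hz
      rw [hLe] at hz hp hp'
      obtain ⟨t, rfl⟩ := aline_two y w (φ p) (φ p') hp hp' (fun h => hpp (hφ h)) z hz
      rw [← hφa, hLsmem]
      exact pf_affine d p p' hd t
    have heq : L = Ls (d, pf d p) := by
      apply Finset.eq_of_subset_of_card_le hsub
      rw [hLscard, hLe, aline_card y w hw]
    rw [mem_image]
    exact ⟨(d, pf d p), by simp only [S, mem_filter, mem_univ, true_and]; rw [← heq]; exact hL,
      heq.symm⟩
  have hSsub : S.image Ls ⊆ C := by
    intro L hL
    rw [mem_image] at hL
    obtain ⟨y, hy, rfl⟩ := hL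
    simpa [S] using hy
  have hScard : (S.image Ls).card = S.card := card_image_of_injective _ hLsinj
  have hS1 : 1 < S.card := by
    rw [← hScard]
    have hx0 : φ (0, 0) = x := by simp [φ]
    have hxu : φ (1, 0) = x + u := by simp [φ]
    have hxv : φ (0, 1) = x + v := by simp [φ]
    apply Finset.one_lt_card.mpr
    refine ⟨_, htwo _ h1 (0, 0) (1, 0) ?_ ?_ (by simp), _,
      htwo _ h2 (0, 0) (0, 1) ?_ ?_ (by simp), hne⟩
    · rw [hx0]; exact mem_aline x u
    · rw [hxu]; simp only [aline, mem_image, mem_univ, true_and]; exact ⟨1, by simp⟩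
    · rw [hx0]; exact mem_aline x v
    · rw [hxv]; simp only [aline, mem_image, mem_univ, true_and]; exact ⟨1, by simp⟩
  have hplane := plane pf pf_bij hq hDc S hS1
  let R := C \ S.image Ls
  have hR : R.card + S.card = C.card := by
    rw [← hScard]; exact Finset.card_sdiff_add_card_eq_card hSsub
  have hdeg : ∀ p, (∀ L ∈ R, φ p ∉ L) → (C.filter fun L => φ p ∈ L).card = deg pf S p := by
    intro p hp
    have : (C.filter fun L => φ p ∈ L) =
        (univ.filter fun d => (d, pf d p) ∈ S).image fun d => Ls (d, pf d p) := by
      ext L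
      simp only [mem_filter, mem_image, mem_univ, true_and]
      constructor
      · rintro ⟨hL, hpL⟩
        have : L ∈ S.image Ls := by
          by_contra hn
          exact hp L (by simp only [R, mem_sdiff]; exact ⟨hL, hn⟩) hpL
        rw [mem_image] at this
        obtain ⟨⟨d, b⟩, hy, rfl⟩ := this
        rw [hLsmem] at hpL
        subst hpL
        exact ⟨d, hy, rfl⟩
      · rintro ⟨d, hd, rfl⟩
        refine ⟨by simpa [S] using hd, ?_⟩
        rw [hLsmem]
    rw [this, card_image_of_injective, deg]
    intro d d' h
    exact congrArg Prod.fst (hLsinj h)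
  have hbd : (oddPts pf S).card ≤
      (Finset.univ.filter fun p : V => ¬ Even ((C.filter fun L => p ∈ L).card)).card + R.card := by
    have hsub : oddPts pf S ⊆
        (univ.filter fun p => ¬ Even ((C.filter fun L => φ p ∈ L).card)) ∪
          R.biUnion fun L => univ.filter fun p => φ p ∈ L := by
      intro p hp
      by_cases hh : ∀ L ∈ R, φ p ∉ L
      · apply mem_union_left
        simp only [mem_filter, mem_univ, true_and, oddPts] at hp ⊢
        rw [hdeg p hh]; exact hp
      · apply mem_union_right
        push Not at hh
        simpa using hh
    refine (card_le_card hsub).trans ((card_union_le _ _).trans (add_le_add ?_ ?_))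
    · refine card_le_card_of_injOn φ ?_ hφ.injOn
      intro p hp
      simpa using hp
    · refine (card_biUnion_le_card_mul _ _ 1 ?_).trans (by simp)
      intro L hL
      rw [Finset.card_le_one]
      intro p hp p' hp'
      simp only [R, mem_sdiff] at hL
      by_contra hpp
      exact hL.2 (htwo L hL.1 p p' (by simpa using hp) (by simpa using hp') hpp)
  omega

theorem main (hq : Odd (Fintype.card K)) (C : Finset (Finset V))
    (hlines : ∀ L ∈ C, ∃ x d : V, d ≠ 0 ∧ L = aline (F := K) x d) (h1 : 1 < C.card) :
    2 * Fintype.card K ≤ C.card +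
      (Finset.univ.filter fun p : V => ¬ Even ((C.filter fun L => p ∈ L).card)).card := by
  by_cases hmeet : ∃ L₁ ∈ C, ∃ L₂ ∈ C, L₁ ≠ L₂ ∧ ∃ x, x ∈ L₁ ∧ x ∈ L₂
  · obtain ⟨L₁, hL₁, L₂, hL₂, hne, x, hx₁, hx₂⟩ := hmeet
    obtain ⟨y, u, hu, rfl⟩ := hlines L₁ hL₁
    obtain ⟨z, v, hv, rfl⟩ := hlines L₂ hL₂
    rw [aline_base y u x hx₁] at hL₁ hne
    rw [aline_base z v x hx₂] at hL₂ hne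
    exact glue hq C hlines x u v hu hv hL₁ hL₂ hne
  · push Not at hmeet
    obtain ⟨L₁, hL₁, L₂, hL₂, hne⟩ := Finset.one_lt_card.mp h1
    have hone : ∀ L ∈ C, ∀ p ∈ L, (C.filter fun L => p ∈ L).card = 1 := by
      intro L hL p hp
      rw [Finset.card_eq_one]
      refine ⟨L, ?_⟩
      ext M
      simp only [mem_filter, mem_singleton]
      constructor
      · rintro ⟨hM, hpM⟩
        by_contra hML
        exact hmeet M hM L hL hML p hpM hp
      · rintro rfl; exact ⟨hL, hp⟩
    have hcard : ∀ L ∈ C, L.card = Fintype.card K := by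
      intro L hL
      obtain ⟨y, u, hu, rfl⟩ := hlines L hL
      exact aline_card y u hu
    have hsub : L₁ ∪ L₂ ⊆
        Finset.univ.filter fun p : V => ¬ Even ((C.filter fun L => p ∈ L).card) := by
      intro p hp
      simp only [mem_filter, mem_univ, true_and]
      rcases mem_union.mp hp with h | h
      · rw [hone L₁ hL₁ p h]; decide
      · rw [hone L₂ hL₂ p h]; decide
    have hdis : Disjoint L₁ L₂ := by
      rw [Finset.disjoint_left]
      intro p hp hp'
      exact hmeet L₁ hL₁ L₂ hL₂ hne p hp hp'
    have := card_le_card hsub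
    rw [card_union_of_disjoint hdis, hcard L₁ hL₁, hcard L₂ hL₂] at this
    omega

end glue

end PlaneAux


/-- For an odd prime power q and integer m ≥ 2, let (V,B) be the S(2,q,q^m) formed by
points and lines of AG(m,q) (points: vectors of F_q^m; lines: sets {x + t•d : t ∈ F_q},
d ≠ 0). For any configuration C of lines with 1 < |C| ≤ 2q−1, it holds that
|C| + odd(C) ≥ 2q, where odd(C) is the number of points contained in an odd number of
blocks of C. -/
theorem stmt_18 (q m : ℕ) (F : Type) [Field F] [Fintype F] [DecidableEq F]
    (hcard : Fintype.card F = q) (hodd : Odd q) (hm : 2 ≤ m)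
    (C : Finset (Finset (Fin m → F)))
    (hlines : ∀ L ∈ C, ∃ x d : Fin m → F, d ≠ 0 ∧
      L = Finset.univ.image fun t : F => x + t • d)
    (h1 : 1 < C.card) (h2 : C.card ≤ 2 * q - 1) :
    2 * q ≤ C.card +
      (Finset.univ.filter fun p : Fin m → F =>
        ¬ Even ((C.filter fun L => p ∈ L).card)).card := by
  subst hcard
  refine PlaneAux.main (K := F) hodd C ?_ h1
  exact hlines
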